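/- arXiv:2312.16666 — 2 statements merged into one kernel-verified Lean document; each statement's English description precedes it below -/
import Mathlib

section
/- Suppose W is finite with longest element w_S, let J ⊆ S and set J̄ = w_S·J·w_S. There exists a bijection f from the set of core (I,J)-cosets (I ⊆ S varying) onto the set of core (J̄,M)-cosets (M ⊆ S varying) such that, for all core cosets p, q with right index J: p ≤_l q if and only if f(q) ≤_r f(p). -/
namespace CoxeterAtoms

variable {B : Type*} {W : Type*} [Group W] {M : CoxeterMatrix B}

/-- The standard parabolic subgroup `W_K` generated by the simple reflections indexed by `K`. -/
def par (cs : CoxeterSystem M W) (K : Set B) : Subgroup W :=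
  Subgroup.closure (cs.simple '' K)

/-- `K` is finitary if `W_K` is finite. -/
def Finitary (cs : CoxeterSystem M W) (K : Set B) : Prop :=
  ((par cs K : Set W)).Finite

/-- The left coset `W_I · x`. -/
def lcos (cs : CoxeterSystem M W) (I : Set B) (x : W) : Set W :=
  {w | ∃ a ∈ par cs I, w = a * x}

/-- The right coset `x · W_J`. -/
def rcos (cs : CoxeterSystem M W) (x : W) (J : Set B) : Set W :=
  {w | ∃ b ∈ par cs J, w = x * b}

/-- The double coset `W_I · x · W_J`. -/
def dcos (cs : CoxeterSystem M W) (I : Set B) (x : W) (J : Set B) : Set W :=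
  {w | ∃ a ∈ par cs I, ∃ b ∈ par cs J, w = a * x * b}

/-- `x` is a minimal length element of its double coset `W_I · x · W_J`. -/
def IsMinRep (cs : CoxeterSystem M W) (I : Set B) (x : W) (J : Set B) : Prop :=
  ∀ w ∈ dcos cs I x J, cs.length x ≤ cs.length w

/-- `y` is a maximal length element of the set `p`. -/
def IsMaxOf (cs : CoxeterSystem M W) (p : Set W) (y : W) : Prop :=
  y ∈ p ∧ ∀ w ∈ p, cs.length w ≤ cs.length y

/-- `y` is the longest element of the standard parabolic subgroup `W_K`. -/
def IsLongest (cs : CoxeterSystem M W) (K : Set B) (y : W) : Prop :=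
  y ∈ par cs K ∧ ∀ w ∈ par cs K, cs.length w ≤ cs.length y

/-- The double coset `W_I · x · W_J` is core: `W_I·x = W_I·x·W_J = x·W_J`. -/
def IsCore (cs : CoxeterSystem M W) (I : Set B) (x : W) (J : Set B) : Prop :=
  lcos cs I x = dcos cs I x J ∧ dcos cs I x J = rcos cs x J

/-- The left weak Bruhat order condition: `p ≤_l q`, where `p` is a core `(Ip,J)`-coset with
maximal element `pbar` and `q` a core coset (with the same right index `J`) with maximal
element `qbar`: there are a finitary `K` and `z : W` such that, with `r = W_K·z·W_{Ip}`,
one has `q̄ = r̄ · w_{Ip} · p̄` and `ℓ(q̄) = ℓ(r̄) − ℓ(w_{Ip}) + ℓ(p̄)`. -/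
def LeL (cs : CoxeterSystem M W) (Ip : Set B) (pbar qbar : W) : Prop :=
  ∃ wIp : W, IsLongest cs Ip wIp ∧
    ∃ K : Set B, Finitary cs K ∧ ∃ z rbar : W,
      IsMaxOf cs (dcos cs K z Ip) rbar ∧
      qbar = rbar * wIp * pbar ∧
      (cs.length qbar : ℤ) = (cs.length rbar : ℤ) - cs.length wIp + cs.length pbar

/-- The set of core `(I,J)`-cosets with fixed right index `J`, encoded as pairs
`(I, x)` where `x` is the minimal element of the coset `W_I·x·W_J`. -/
def CoreRight (cs : CoxeterSystem M W) (J : Set B) : Set (Set B × W) :=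
  {p | Finitary cs p.1 ∧ IsMinRep cs p.1 p.2 J ∧ IsCore cs p.1 p.2 J}

/-- The set of core `(I,M)`-cosets with fixed left index `I`, encoded as pairs
`(M, x)` where `x` is the minimal element of the coset `W_I·x·W_M`. -/
def CoreLeft (cs : CoxeterSystem M W) (I : Set B) : Set (Set B × W) :=
  {q | Finitary cs q.1 ∧ IsMinRep cs I q.2 q.1 ∧ IsCore cs I q.2 q.1}

/-- `p ≤_l q` for two core cosets with right index `J`, encoded as pairs. -/
def LeLPair (cs : CoxeterSystem M W) (J : Set B) (p q : Set B × W) : Prop :=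
  ∃ pbar qbar : W, IsMaxOf cs (dcos cs p.1 p.2 J) pbar ∧
    IsMaxOf cs (dcos cs q.1 q.2 J) qbar ∧ LeL cs p.1 pbar qbar

/-- `p ≤_r q` for two core cosets with left index `I`, encoded as pairs `(J_p, x_p)`. -/
def LeRPair (cs : CoxeterSystem M W) (I : Set B) (p q : Set B × W) : Prop :=
  ∃ pbar qbar : W, IsMaxOf cs (dcos cs I p.2 p.1) pbar ∧
    IsMaxOf cs (dcos cs I q.2 q.1) qbar ∧
    ∃ wJp : W, IsLongest cs p.1 wJp ∧
      ∃ K : Set B, Finitary cs K ∧ ∃ z rbar : W,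
        IsMaxOf cs (dcos cs p.1 z K) rbar ∧
        qbar = pbar * wJp * rbar ∧
        (cs.length qbar : ℤ) = (cs.length pbar : ℤ) - cs.length wJp + cs.length rbar

/-- The reflection-sign action of a simple reflection. -/
noncomputable def act (cs : CoxeterSystem M W) (i : B) : Function.End (W × ZMod 2) :=
  open Classical in
  fun p => (cs.simple i * p.1 * cs.simple i, p.2 + if p.1 = cs.simple i then 1 else 0)

lemma pow_aux (a b : W) (ha : a * a = 1) (hb : b * b = 1) (k : ℕ) :
    b * (a * b) ^ k = ((a * b) ^ k)⁻¹ * b := by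
  have ha' : a⁻¹ = a := inv_eq_of_mul_eq_one_left ha
  have hb' : b⁻¹ = b := inv_eq_of_mul_eq_one_left hb
  have h : SemiconjBy b (a * b) (a * b)⁻¹ := by
    simp only [SemiconjBy, mul_inv_rev, ha', hb', mul_assoc]
  have := h.pow_right k
  rw [inv_pow] at this
  exact this

lemma act_pow (cs : CoxeterSystem M W) (i j : B) (n : ℕ) (t : W) (e : ZMod 2) :
    open Classical in
    ((act cs i * act cs j) ^ n) (t, e) =
      ((cs.simple i * cs.simple j) ^ n * t * ((cs.simple i * cs.simple j) ^ n)⁻¹,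
        e + ∑ k ∈ Finset.range (2 * n),
          if t = cs.simple j * (cs.simple i * cs.simple j) ^ k then 1 else 0) := by
  classical
  induction n with
  | zero => simp; rfl
  | succ n ih =>
    rw [pow_succ']
    change act cs i (act cs j (((act cs i * act cs j) ^ n) (t, e))) = _
    rw [ih]
    have hi := cs.simple_mul_simple_self i
    have hj := cs.simple_mul_simple_self j
    have hi' := cs.inv_simple i
    have hj' := cs.inv_simple j
    have key := pow_aux (cs.simple i) (cs.simple j) hi hj n
    simp only [act]
    have e1 : ((cs.simple i * cs.simple j) ^ n * t * ((cs.simple i * cs.simple j) ^ n)⁻¹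
        = cs.simple j) ↔ t = cs.simple j * (cs.simple i * cs.simple j) ^ (2 * n) := by
      rw [two_mul, pow_add, ← mul_assoc (cs.simple j), key]
      generalize (cs.simple i * cs.simple j) ^ n = c
      constructor
      · intro h; rw [← h]; group
      · intro h; rw [h]; group
    have e2 : (cs.simple j * ((cs.simple i * cs.simple j) ^ n * t *
        ((cs.simple i * cs.simple j) ^ n)⁻¹) * cs.simple j
        = cs.simple i) ↔ t = cs.simple j * (cs.simple i * cs.simple j) ^ (2 * n + 1) := by
      have : cs.simple j * (cs.simple i * cs.simple j) ^ (2 * n + 1) =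
         ((cs.simple i * cs.simple j) ^ n)⁻¹ * (cs.simple j * cs.simple i * cs.simple j) *
           (cs.simple i * cs.simple j) ^ n := by
        rw [show 2 * n + 1 = n + 1 + n by ring, pow_add, pow_succ, ← mul_assoc, ← mul_assoc,
          key]
        simp only [mul_assoc]
      rw [this]
      generalize (cs.simple i * cs.simple j) ^ n = c
      constructor
      · intro h
        rw [← h]
        simp [mul_assoc]
      · intro h; rw [h]; simp [mul_assoc]
    rw [show 2 * (n + 1) = 2 * n + 1 + 1 by ring, Finset.sum_range_succ, Finset.sum_range_succ]
    simp only [e1, e2]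
    ext
    · simp only [pow_succ' _ n, mul_inv_rev, hi', hj', mul_assoc]
    · simp only [add_assoc]

lemma act_liftable (cs : CoxeterSystem M W) : M.IsLiftable (act cs) := by
  classical
  intro i j
  funext ⟨t, e⟩
  rw [act_pow, two_mul, Finset.sum_range_add]
  have h := cs.simple_mul_simple_pow i j
  simp only [pow_add, h, one_mul]
  rw [CharTwo.add_self_eq_zero]
  simp
  rfl

/-- The reflection-sign homomorphism. -/
noncomputable def phi (cs : CoxeterSystem M W) : W →* Function.End (W × ZMod 2) :=
  cs.lift ⟨act cs, act_liftable cs⟩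

lemma phi_word (cs : CoxeterSystem M W) (ω : List B) (t : W) (e : ZMod 2) :
    open Classical in
    phi cs (cs.wordProd ω) (t, e) =
      (cs.wordProd ω * t * (cs.wordProd ω)⁻¹, e + ((cs.rightInvSeq ω).count t : ℕ)) := by
  classical
  induction ω with
  | nil => simp; rfl
  | cons i ω ih =>
    rw [cs.wordProd_cons, map_mul]
    change phi cs (cs.simple i) (phi cs (cs.wordProd ω) (t, e)) = _
    rw [ih, phi, cs.lift_apply_simple, CoxeterSystem.rightInvSeq, List.count_cons]
    simp only [act]
    have : (cs.wordProd ω * t * (cs.wordProd ω)⁻¹ = cs.simple i) ↔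
       (((cs.wordProd ω)⁻¹ * cs.simple i * cs.wordProd ω == t) = true) := by
      rw [beq_iff_eq]
      constructor
      · intro h; rw [← h]; group
      · intro h; rw [← h]; group
    simp only [this]
    ext
    · simp [mul_assoc]
    · push_cast; simp only [add_assoc]

/-- The inversion indicator. -/
noncomputable def eta (cs : CoxeterSystem M W) (w t : W) : ZMod 2 := (phi cs w (t, 0)).2

lemma phi_eq (cs : CoxeterSystem M W) (w t : W) (e : ZMod 2) :
    phi cs w (t, e) = (w * t * w⁻¹, e + eta cs w t) := by
  obtain ⟨ω, rfl⟩ := cs.wordProd_surjective w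
  rw [eta, phi_word, phi_word]; simp

lemma eta_mul (cs : CoxeterSystem M W) (u v t : W) :
    eta cs (u * v) t = eta cs v t + eta cs u (v * t * v⁻¹) := by
  have : phi cs (u * v) (t, 0) = phi cs u (phi cs v (t, 0)) := by rw [map_mul]; rfl
  rw [phi_eq, phi_eq, phi_eq] at this
  simpa using congrArg Prod.snd this

lemma eta_simple (cs : CoxeterSystem M W) (i : B) : eta cs (cs.simple i) (cs.simple i) = 1 := by
  rw [eta, phi, cs.lift_apply_simple]; simp [act]

lemma eta_self (cs : CoxeterSystem M W) {t : W} (ht : cs.IsReflection t) : eta cs t t = 1 := by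
  obtain ⟨u, i, rfl⟩ := ht
  have h1 : eta cs (u * u⁻¹) (u * cs.simple i * u⁻¹) = 0 := by
    rw [mul_inv_cancel, eta, map_one]; rfl
  rw [eta_mul] at h1
  rw [eta_mul, eta_mul]
  have e1 : u⁻¹ * (u * cs.simple i * u⁻¹) * u⁻¹⁻¹ = cs.simple i := by group
  rw [e1] at h1
  have e2 : cs.simple i * cs.simple i * (cs.simple i)⁻¹ = cs.simple i := by group
  rw [e1, e2, eta_simple]
  linear_combination h1

lemma lt_of_eta (cs : CoxeterSystem M W) {w t : W} (h : eta cs w t = 1) :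
    cs.length (w * t) < cs.length w := by
  classical
  obtain ⟨ω, hω, rfl⟩ := cs.exists_isReduced w
  have : t ∈ cs.rightInvSeq ω := by
    by_contra hn
    rw [eta, phi_word, List.count_eq_zero_of_not_mem hn] at h
    simp at h
  exact (cs.isRightInversion_of_mem_rightInvSeq hω this).2

lemma eta_of_lt (cs : CoxeterSystem M W) {w t : W} (ht : cs.IsReflection t)
    (h : cs.length (w * t) < cs.length w) : eta cs w t = 1 := by
  by_contra hn
  have h0 : eta cs w t = 0 := by
    generalize eta cs w t = x at *
    revert x; decide
  have : eta cs (w * t) t = 1 := by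
    rw [eta_mul, eta_self cs ht]
    simp [h0]
  have := lt_of_eta cs this
  rw [mul_assoc, ht.mul_self, mul_one] at this
  omega

/-- Strong exchange for a product of two elements. -/
lemma exch (cs : CoxeterSystem M W) {u v t : W} (ht : cs.IsReflection t)
    (h : cs.length (u * v * t) < cs.length (u * v)) :
    cs.length (v * t) < cs.length v ∨ cs.length (u * (v * t * v⁻¹)) < cs.length u := by
  have h1 := eta_of_lt cs ht h
  rw [eta_mul] at h1
  by_cases hv : eta cs v t = 1
  · exact Or.inl (lt_of_eta cs hv)
  · right
    apply lt_of_eta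
    generalize eta cs v t = x at *
    generalize eta cs u (v * t * v⁻¹) = y at *
    revert x y; decide

lemma par_ind (cs : CoxeterSystem M W) (K : Set B) (P : W → Prop) (h1 : P 1)
    (hs : ∀ u ∈ par cs K, P u → ∀ i ∈ K, P (u * cs.simple i)) : ∀ u ∈ par cs K, P u := by
  intro u hu
  unfold par at hu
  induction hu using Subgroup.closure_induction_right with
  | one => exact h1
  | mul_right x hx y hy ih =>
    obtain ⟨i, hi, rfl⟩ := hy
    exact hs x hx ih i hi
  | mul_inv_cancel x hx y hy ih =>
    obtain ⟨i, hi, rfl⟩ := hy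
    rw [cs.inv_simple]
    exact hs x hx ih i hi

lemma simple_mem (cs : CoxeterSystem M W) {K : Set B} {i : B} (hi : i ∈ K) :
    cs.simple i ∈ par cs K := Subgroup.subset_closure ⟨i, hi, rfl⟩

lemma len_min (cs : CoxeterSystem M W) {J : Set B} {x : W}
    (hx : ∀ u ∈ par cs J, cs.length x ≤ cs.length (x * u)) :
    ∀ u ∈ par cs J, cs.length (x * u) = cs.length x + cs.length u := by
  apply par_ind
  · simp
  · intro u hu ih i hi
    have h1 := cs.length_mul_simple u i
    have h2 := cs.length_mul_simple (x * u) i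
    have h3 := cs.length_mul_le x (u * cs.simple i)
    rw [← mul_assoc] at h3 ⊢
    by_contra hne
    have hlt : cs.length (x * u * cs.simple i) < cs.length (x * u) := by omega
    rcases exch cs (cs.isReflection_simple i) hlt with h | h
    · omega
    · have := hx (u * cs.simple i * u⁻¹)
        (mul_mem (mul_mem hu (simple_mem cs hi)) (inv_mem hu))
      omega

lemma len_max (cs : CoxeterSystem M W) {J : Set B} {x : W}
    (hx : ∀ t ∈ par cs J, cs.IsReflection t → cs.length (x * t) < cs.length x) :
    ∀ u ∈ par cs J, cs.length (x * u) + cs.length u = cs.length x := by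
  apply par_ind
  · simp
  · intro u hu ih i hi
    have h1 := cs.length_mul_simple u i
    have h2 := cs.length_mul_simple (x * u) i
    have h3 := cs.length_le_length_mul_add_right x (u * cs.simple i)
    rw [← mul_assoc] at h3 ⊢
    by_contra hne
    have ht : cs.IsReflection (u * cs.simple i * u⁻¹) := (cs.isReflection_simple i).conj u
    have hlt := hx _ (mul_mem (mul_mem hu (simple_mem cs hi)) (inv_mem hu)) ht
    have hlt' : cs.length ((x * u) * u⁻¹ * (u * cs.simple i * u⁻¹)) <
        cs.length ((x * u) * u⁻¹) := by simpa using hlt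
    rcases exch cs ht hlt' with h | h
    · rw [show u⁻¹ * (u * cs.simple i * u⁻¹) = (u * cs.simple i)⁻¹ by simp [mul_assoc],
        cs.length_inv, cs.length_inv] at h
      omega
    · rw [show u⁻¹ * (u * cs.simple i * u⁻¹) * u⁻¹⁻¹ = cs.simple i by group] at h
      omega

lemma len_max' (cs : CoxeterSystem M W) {J : Set B} {x : W}
    (hx : ∀ u ∈ par cs J, cs.length (x * u) ≤ cs.length x) :
    ∀ u ∈ par cs J, cs.length (x * u) + cs.length u = cs.length x :=
  len_max cs fun t ht hr => lt_of_le_of_ne (hx t ht) (hr.length_mul_left_ne x)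

lemma exists_longest (cs : CoxeterSystem M W) [Finite W] (K : Set B) :
    ∃ w, IsLongest cs K w := by
  obtain ⟨w, hw, h⟩ := Set.exists_max_image (par cs K : Set W) cs.length (Set.toFinite _)
    ⟨1, one_mem _⟩
  exact ⟨w, hw, h⟩

lemma IsLongest.len {cs : CoxeterSystem M W} {K : Set B} {w : W} (h : IsLongest cs K w) :
    ∀ u ∈ par cs K, cs.length (w * u) + cs.length u = cs.length w :=
  len_max' cs fun u hu => h.2 _ (mul_mem h.1 hu)

lemma IsLongest.unique {cs : CoxeterSystem M W} {K : Set B} {w v : W} (h : IsLongest cs K w)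
    (h' : IsLongest cs K v) : w * v = 1 := by
  have h1 := h.len v h'.1
  have h2 := h'.2 w h.1
  rw [← cs.length_eq_zero_iff]
  omega

lemma IsLongest.sq {cs : CoxeterSystem M W} {K : Set B} {w : W} (h : IsLongest cs K w) :
    w * w = 1 := h.unique h

lemma IsLongest.inv {cs : CoxeterSystem M W} {K : Set B} {w : W} (h : IsLongest cs K w) :
    w⁻¹ = w := inv_eq_of_mul_eq_one_left h.sq

lemma IsLongest.eq {cs : CoxeterSystem M W} {K : Set B} {w v : W} (h : IsLongest cs K w)
    (h' : IsLongest cs K v) : w = v := by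
  rw [← h.inv]; exact inv_eq_of_mul_eq_one_right (h.unique h')

/-- A convenient form of "core coset with minimal element `x`". -/
structure Cor (cs : CoxeterSystem M W) (I : Set B) (x : W) (J : Set B) : Prop where
  r : ∀ a ∈ par cs I, x⁻¹ * a * x ∈ par cs J
  l : ∀ b ∈ par cs J, x * b * x⁻¹ ∈ par cs I
  m : ∀ b ∈ par cs J, cs.length x ≤ cs.length (x * b)

lemma Cor.mem {cs : CoxeterSystem M W} {I : Set B} {x : W} {J : Set B} (h : Cor cs I x J) (w : W) :
    w ∈ dcos cs I x J ↔ ∃ b ∈ par cs J, w = x * b := by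
  constructor
  · rintro ⟨a, ha, b, hb, rfl⟩
    exact ⟨x⁻¹ * a * x * b, mul_mem (h.r a ha) hb, by group⟩
  · rintro ⟨b, hb, rfl⟩
    exact ⟨1, one_mem _, b, hb, by simp⟩

lemma cor_iff (cs : CoxeterSystem M W) (I : Set B) (x : W) (J : Set B) :
    Cor cs I x J ↔ (IsMinRep cs I x J ∧ IsCore cs I x J) := by
  constructor
  · intro h
    refine ⟨?_, ?_, ?_⟩
    · intro w hw
      obtain ⟨b, hb, rfl⟩ := (h.mem w).1 hw
      exact h.m b hb
    · ext w
      rw [h.mem]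
      constructor
      · rintro ⟨a, ha, rfl⟩
        exact ⟨_, h.r a ha, by group⟩
      · rintro ⟨b, hb, rfl⟩
        exact ⟨_, h.l b hb, by group⟩
    · ext w
      rw [h.mem]; rfl
  · rintro ⟨hm, h1, h2⟩
    refine ⟨?_, ?_, ?_⟩
    · intro a ha
      have : a * x ∈ rcos cs x J := by rw [← h2, ← h1]; exact ⟨a, ha, rfl⟩
      obtain ⟨b, hb, e⟩ := this
      rw [mul_assoc, e]; simpa using hb
    · intro b hb
      have : x * b ∈ lcos cs I x := by rw [h1, h2]; exact ⟨b, hb, rfl⟩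
      obtain ⟨a, ha, e⟩ := this
      rw [e]; simpa using ha
    · intro b hb
      exact hm _ ⟨1, one_mem _, b, hb, by simp⟩

lemma Cor.inv {cs : CoxeterSystem M W} {I : Set B} {x : W} {J : Set B} (h : Cor cs I x J) :
    Cor cs J x⁻¹ I := by
  refine ⟨fun a ha => by simpa using h.l a ha, fun a ha => by simpa using h.r a ha, ?_⟩
  intro a ha
  have := h.m _ (h.r _ (inv_mem ha))
  rw [← cs.length_inv (x⁻¹ * a), cs.length_inv]
  convert this using 2
  group

lemma Cor.lenr {cs : CoxeterSystem M W} {I : Set B} {x : W} {J : Set B} (h : Cor cs I x J) :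
    ∀ b ∈ par cs J, cs.length (x * b) = cs.length x + cs.length b := len_min cs h.m

lemma Cor.lenl {cs : CoxeterSystem M W} {I : Set B} {x : W} {J : Set B} (h : Cor cs I x J) :
    ∀ a ∈ par cs I, cs.length (a * x) = cs.length a + cs.length x := by
  intro a ha
  have := h.inv.lenr _ (inv_mem ha)
  rw [← mul_inv_rev, cs.length_inv, cs.length_inv, cs.length_inv] at this
  omega

lemma Cor.len_conj {cs : CoxeterSystem M W} {I : Set B} {x : W} {J : Set B} (h : Cor cs I x J)
    {b : W} (hb : b ∈ par cs J) : cs.length (x * b * x⁻¹) = cs.length b := by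
  have h1 := h.lenr b hb
  have h2 := h.lenl _ (h.l b hb)
  rw [inv_mul_cancel_right] at h2
  omega

lemma Cor.longest {cs : CoxeterSystem M W} {I : Set B} {x : W} {J : Set B} (h : Cor cs I x J)
    {w : W} (hw : IsLongest cs J w) : IsLongest cs I (x * w * x⁻¹) := by
  refine ⟨h.l _ hw.1, fun a ha => ?_⟩
  rw [h.len_conj hw.1]
  have := h.inv.len_conj ha
  rw [← this]
  exact hw.2 _ (by simpa using h.r a ha)

lemma Cor.swap {cs : CoxeterSystem M W} {I : Set B} {x : W} {J : Set B} (h : Cor cs I x J)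
    {w v : W} (hw : IsLongest cs I w) (hv : IsLongest cs J v) : w * x = x * v := by
  rw [hw.eq (h.longest hv)]; group

lemma Cor.max_iff {cs : CoxeterSystem M W} {I : Set B} {x : W} {J : Set B} (h : Cor cs I x J)
    {v : W} (hv : IsLongest cs J v) (y : W) : IsMaxOf cs (dcos cs I x J) y ↔ y = x * v := by
  constructor
  · rintro ⟨hy, hm⟩
    obtain ⟨b, hb, rfl⟩ := (h.mem y).1 hy
    rw [hv.eq (v := b) ⟨hb, ?_⟩]
    intro c hc
    have := hm (x * c) ((h.mem _).2 ⟨c, hc, rfl⟩)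
    rw [h.lenr c hc, h.lenr b hb] at this
    omega
  · rintro rfl
    refine ⟨(h.mem _).2 ⟨v, hv.1, rfl⟩, fun w hw => ?_⟩
    obtain ⟨b, hb, rfl⟩ := (h.mem w).1 hw
    rw [h.lenr b hb, h.lenr v hv.1]
    have := hv.2 b hb
    omega

/-- Both maximality conditions on `r` hold automatically. -/
lemma auto_max (cs : CoxeterSystem M W) {J Ip Iq : Set B} {x y wp wq v : W}
    (hp : Cor cs Ip x J) (hq : Cor cs Iq y J) (hwp : IsLongest cs Ip wp)
    (hwq : IsLongest cs Iq wq) (hv : IsLongest cs J v) :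
    (∀ a ∈ par cs Ip, cs.length (wq * y * x⁻¹ * a) ≤ cs.length (wq * y * x⁻¹)) ∧
    (∀ a ∈ par cs Iq, cs.length (a * (wq * y * x⁻¹)) ≤ cs.length (wq * y * x⁻¹)) := by
  have hR : ∀ a ∈ par cs Ip, cs.length (wq * y * x⁻¹ * a) + cs.length a =
      cs.length (wq * y * x⁻¹) := by
    apply len_max
    intro t ht hr
    have ht' : cs.IsReflection (x⁻¹ * t * x) := by simpa using hr.conj x⁻¹
    have hm := hp.r t ht
    have hlt : cs.length (wq * y * x⁻¹ * x * (x⁻¹ * t * x)) < cs.length (wq * y * x⁻¹ * x) := by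
      rw [inv_mul_cancel_right]
      refine lt_of_le_of_ne ?_ (ht'.length_mul_left_ne _)
      rw [hq.swap hwq hv, mul_assoc, hq.lenr _ (mul_mem hv.1 hm), hq.lenr _ hv.1]
      have := hv.2 _ (mul_mem hv.1 hm)
      omega
    rcases exch cs ht' hlt with h | h
    · have := hp.m _ hm
      omega
    · rwa [show x * (x⁻¹ * t * x) * x⁻¹ = t by group] at h
  refine ⟨fun a ha => by have := hR a ha; omega, fun a ha => ?_⟩
  have h1 := hR wp hwp.1
  have e1 : wq * y * x⁻¹ * wp = y * x⁻¹ := by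
    have := hp.swap hwp hv
    rw [hq.swap hwq hv]
    have e2 : wp = x * v * x⁻¹ := by rw [← this]; group
    rw [e2, show y * v * x⁻¹ * (x * v * x⁻¹) = y * (v * v) * x⁻¹ by group, hv.sq, mul_one]
  have e3 : cs.length wq = cs.length wp := by
    rw [hwq.eq (hq.longest hv), hwp.eq (hp.longest hv), hq.len_conj hv.1, hp.len_conj hv.1]
  rw [e1] at h1
  have h2 := cs.length_mul_le (a * wq) (y * x⁻¹)
  have h3 := hwq.2 _ (mul_mem ha hwq.1)
  rw [show a * (wq * y * x⁻¹) = a * wq * (y * x⁻¹) by group]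
  omega

lemma par_empty (cs : CoxeterSystem M W) (a : W) : a ∈ par cs ∅ ↔ a = 1 := by
  simp [par]

lemma leL_iff (cs : CoxeterSystem M W) [Finite W] {J Ip Iq : Set B} {x y wp wq v : W}
    (hp : Cor cs Ip x J) (hq : Cor cs Iq y J) (hwp : IsLongest cs Ip wp)
    (hwq : IsLongest cs Iq wq) (hv : IsLongest cs J v) :
    LeLPair cs J (Ip, x) (Iq, y) ↔
      cs.length (wq * y) = cs.length (wq * y * x⁻¹) + cs.length x := by
  have hlen := hp.lenl _ hwp.1
  constructor
  · rintro ⟨pb, qb, h1, h2, w, hw, K, -, z, r, -, e, el⟩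
    rw [hp.max_iff hv, ← hp.swap hwp hv] at h1
    rw [hq.max_iff hv, ← hq.swap hwq hv] at h2
    obtain rfl := hwp.eq hw
    subst h1 h2
    have e' : r = wq * y * x⁻¹ := by
      rw [e, mul_assoc r, ← mul_assoc wp, hwp.sq]; group
    subst e'
    push_cast [hlen] at el
    omega
  · intro hl
    obtain ⟨hm, -⟩ := auto_max cs hp hq hwp hwq hv
    refine ⟨wp * x, wq * y, ?_, ?_, wp, hwp, ∅, Set.toFinite _, wq * y * x⁻¹, wq * y * x⁻¹,
      ⟨⟨1, one_mem _, 1, one_mem _, by simp⟩, ?_⟩, ?_, ?_⟩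
    · rw [hp.max_iff hv, ← hp.swap hwp hv]
    · rw [hq.max_iff hv, ← hq.swap hwq hv]
    · rintro _ ⟨a, ha, b, hb, rfl⟩
      rw [par_empty] at ha
      subst ha
      rw [one_mul]
      exact hm b hb
    · rw [mul_assoc _ wp, ← mul_assoc wp, hwp.sq]; group
    · rw [hlen, hl]; push_cast; ring

theorem statement_12 (cs : CoxeterSystem M W) [Finite W] (wS : W)
    (hwS : ∀ w : W, cs.length w ≤ cs.length wS)
    (J Jbar : Set B)
    (hJbar : cs.simple '' Jbar = (fun v => wS * v * wS) '' (cs.simple '' J)) :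
    ∃ f : Set B × W → Set B × W,
      Set.BijOn f (CoreRight cs J) (CoreLeft cs Jbar) ∧
      ∀ p ∈ CoreRight cs J, ∀ q ∈ CoreRight cs J,
        (LeLPair cs J p q ↔ LeRPair cs Jbar (f q) (f p)) := by
  have htop : ∀ w : W, w ∈ par cs Set.univ := by
    intro w
    rw [par, Set.image_univ, cs.subgroup_closure_range_simple]; trivial
  have hL : IsLongest cs Set.univ wS := ⟨htop _, fun w _ => hwS w⟩
  have sq : wS * wS = 1 := hL.sq
  have winv : wS⁻¹ = wS := hL.inv
  have lenl : ∀ u, cs.length (wS * u) + cs.length u = cs.length wS := fun u => hL.len u (htop u)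
  have lenr : ∀ u, cs.length (u * wS) + cs.length u = cs.length wS := by
    intro u
    have := lenl u⁻¹
    rw [← cs.length_inv (wS * u⁻¹), mul_inv_rev, inv_inv, winv, cs.length_inv] at this
    exact this
  have hconj : par cs Jbar = (par cs J).map (MulAut.conj wS).toMonoidHom := by
    rw [par, par, MonoidHom.map_closure, hJbar]
    congr 2
    funext v
    simp [winv]
  have hc1 : ∀ b ∈ par cs J, wS * b * wS ∈ par cs Jbar := by
    intro b hb
    rw [hconj]
    exact ⟨b, hb, by simp [winv]⟩
  have hc2 : ∀ b ∈ par cs Jbar, wS * b * wS ∈ par cs J := by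
    intro b hb
    rw [hconj] at hb
    obtain ⟨c, hc, rfl⟩ := hb
    have : wS * (wS * c * wS⁻¹) * wS = c := by
      rw [winv, show wS * (wS * c * wS) * wS = (wS * wS) * c * (wS * wS) by group, sq]; simp
    simpa [this] using hc
  choose lw hlw using exists_longest cs
  have hF : ∀ I x, Cor cs I x J → Cor cs Jbar (wS * x⁻¹ * lw I) I := by
    intro I x h
    have hw := hlw I
    refine ⟨?_, ?_, ?_⟩
    · intro a ha
      have h1 := mul_mem (mul_mem hw.1 (h.l _ (hc2 a ha))) hw.1
      convert h1 using 1
      simp only [mul_inv_rev, inv_inv, winv, hw.inv, mul_assoc]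
    · intro b hb
      have h1 := hc1 _ (h.r _ (mul_mem (mul_mem hw.1 hb) hw.1))
      convert h1 using 1
      simp only [mul_inv_rev, inv_inv, winv, hw.inv, mul_assoc]
    · intro b hb
      have h1 := lenl (x⁻¹ * lw I)
      have h2 := lenl (x⁻¹ * (lw I * b))
      have h3 := h.inv.lenr _ hw.1
      have h4 := h.inv.lenr _ (mul_mem hw.1 hb)
      have h5 := hw.2 _ (mul_mem hw.1 hb)
      simp only [mul_assoc] at *
      omega
  have hG : ∀ I y, Cor cs Jbar y I → Cor cs I (lw I * y⁻¹ * wS) J := by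
    intro I y h
    have hw := hlw I
    refine ⟨?_, ?_, ?_⟩
    · intro a ha
      have h1 := hc2 _ (h.l _ (mul_mem (mul_mem hw.1 ha) hw.1))
      convert h1 using 1
      simp only [mul_inv_rev, inv_inv, winv, hw.inv, mul_assoc]
    · intro b hb
      have h1 := mul_mem (mul_mem hw.1 (h.r _ (hc1 b hb))) hw.1
      convert h1 using 1
      simp only [mul_inv_rev, inv_inv, winv, hw.inv, mul_assoc]
    · intro b hb
      have hb' := hc1 b hb
      have e : lw I * y⁻¹ * wS * b = lw I * (y⁻¹ * (wS * b * wS) * y) * y⁻¹ * wS := by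
        rw [show lw I * (y⁻¹ * (wS * b * wS) * y) * y⁻¹ * wS =
          lw I * y⁻¹ * wS * b * (wS * wS) by group, sq, mul_one]
      have hm := h.r _ hb'
      have h1 := lenr (lw I * y⁻¹)
      have h2 := lenr (lw I * (y⁻¹ * (wS * b * wS) * y) * y⁻¹)
      have h3 := h.inv.lenl _ hw.1
      have h4 := h.inv.lenl _ (mul_mem hw.1 hm)
      have h5 := hw.2 _ (mul_mem hw.1 hm)
      rw [e]
      omega
  refine ⟨fun p => (p.1, wS * p.2⁻¹ * lw p.1), ⟨?_, ?_, ?_⟩, ?_⟩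
  · rintro ⟨I, x⟩ ⟨hf, h⟩
    exact ⟨hf, (cor_iff ..).1 (hF I x ((cor_iff ..).2 h))⟩
  · rintro ⟨I, x⟩ - ⟨I', x'⟩ - e
    simp only [Prod.mk.injEq] at e
    obtain ⟨rfl, e⟩ := e
    simpa using e
  · rintro ⟨I, y⟩ ⟨hf, h⟩
    refine ⟨(I, lw I * y⁻¹ * wS), ⟨hf, (cor_iff ..).1 (hG I y ((cor_iff ..).2 h))⟩, ?_⟩
    have hw := hlw I
    simp only [mul_inv_rev, inv_inv, winv, hw.inv, Prod.mk.injEq, true_and]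
    rw [show wS * (wS * (y * lw I)) * lw I = (wS * wS) * y * (lw I * lw I) by group, sq, hw.sq]
    simp
  · rintro ⟨Ip, x⟩ ⟨-, hp⟩ ⟨Iq, y⟩ ⟨-, hq⟩
    have hp : Cor cs Ip x J := (cor_iff ..).2 hp
    have hq : Cor cs Iq y J := (cor_iff ..).2 hq
    have hwp := hlw Ip
    have hwq := hlw Iq
    have hv := hlw J
    rw [leL_iff cs hp hq hwp hwq hv]
    have hFp := hF _ _ hp
    have hFq := hF _ _ hq
    have ep : wS * x⁻¹ * lw Ip * lw Ip = wS * x⁻¹ := by rw [mul_assoc, hwp.sq, mul_one]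
    have eq : wS * y⁻¹ * lw Iq * lw Iq = wS * y⁻¹ := by rw [mul_assoc, hwq.sq, mul_one]
    have lp := lenl x⁻¹
    have lq := lenl y⁻¹
    rw [cs.length_inv] at lp lq
    have hlq := hq.lenl _ hwq.1
    constructor
    · intro hl
      obtain ⟨-, hm⟩ := auto_max cs hp hq hwp hwq hv
      refine ⟨wS * y⁻¹, wS * x⁻¹, ?_, ?_, lw Iq, hwq, ∅, Set.toFinite _, lw Iq * y * x⁻¹,
        lw Iq * y * x⁻¹, ⟨⟨1, one_mem _, 1, one_mem _, by simp⟩, ?_⟩, ?_, ?_⟩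
      · rw [hFq.max_iff hwq, eq]
      · rw [hFp.max_iff hwp, ep]
      · rintro _ ⟨a, ha, b, hb, rfl⟩
        rw [par_empty] at hb
        subst hb
        rw [mul_one]
        exact hm a ha
      · rw [show wS * y⁻¹ * lw Iq * (lw Iq * y * x⁻¹) =
          wS * y⁻¹ * (lw Iq * lw Iq) * y * x⁻¹ by group, hwq.sq]
        group
      · omega
    · rintro ⟨qb, pb, h1, h2, w, hw, K, -, z, r, -, e, el⟩
      dsimp only at h1 h2 hw
      rw [hFq.max_iff hwq, eq] at h1
      rw [hFp.max_iff hwp, ep] at h2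
      obtain rfl := hwq.eq hw
      subst h1 h2
      have e' : r = lw Iq * y * x⁻¹ := by
        have : x⁻¹ = y⁻¹ * lw Iq * r := by
          have := congrArg (wS⁻¹ * ·) e
          simpa [mul_assoc] using this
        rw [this, show lw Iq * y * (y⁻¹ * lw Iq * r) = (lw Iq * lw Iq) * r by group, hwq.sq,
          one_mul]
      subst e'
      omega

end CoxeterAtoms
end

section
/- Let K ⊆ S be finitary, s ∈ K, t = w_K·s·w_K, I = K∖{s} and J = K∖{t}. Then the composition of the atom a = W_I·w_K·W_J with its inverse atom a⁻¹ = W_J·w_K·W_I is not reduced; explicitly, ℓ(w_K·w_J·w_K) < 2·ℓ(w_K) − ℓ(w_J). -/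
namespace CoxeterAtoms

variable {B : Type*} {W : Type*} [Group W] {M : CoxeterMatrix B}

/-- Cartan-type coefficients of the geometric representation. -/
noncomputable def geoForm (M : CoxeterMatrix B) (i : B) : Module.Dual ℝ (B →₀ ℝ) :=
  Finsupp.linearCombination ℝ (fun j => -2 * Real.cos (Real.pi / (M i j : ℝ)))

theorem geoForm_single (M : CoxeterMatrix B) (i j : B) :
    geoForm M i (Finsupp.single j 1) = -2 * Real.cos (Real.pi / (M i j : ℝ)) := by
  simp [geoForm, Finsupp.linearCombination_single]

theorem geoForm_self (M : CoxeterMatrix B) (i : B) :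
    geoForm M i (Finsupp.single i 1) = 2 := by
  simp [geoForm_single, M.diagonal i]

/-- The simple reflections of the geometric representation. -/
noncomputable def geoRefl (M : CoxeterMatrix B) (i : B) : (B →₀ ℝ) ≃ₗ[ℝ] (B →₀ ℝ) :=
  Module.reflection (geoForm_self M i)

theorem geoRefl_apply (M : CoxeterMatrix B) (i : B) (v : B →₀ ℝ) :
    geoRefl M i v = v - (geoForm M i v) • Finsupp.single i 1 :=
  Module.reflection_apply _ _

theorem geo_liftable (M : CoxeterMatrix B) : M.IsLiftable (geoRefl M) := by
  intro i j
  by_cases hij : i = j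
  · subst hij
    rw [M.diagonal, pow_one]
    ext1 v
    exact Module.involutive_reflection (geoForm_self M i) v
  have h1 : M i j ≠ 1 := M.off_diagonal i j hij
  have hsymm : M j i = M i j := M.symmetric j i
  by_cases h0 : M i j = 0
  · rw [h0, pow_zero]
  by_cases h2 : M i j = 2
  · rw [h2]
    ext1 v
    have e1 : geoForm M i (Finsupp.single j 1) = 0 := by
      rw [geoForm_single, h2]; simp
    have e2 : geoForm M j (Finsupp.single i 1) = 0 := by
      rw [geoForm_single, hsymm, h2]; simp
    simp only [pow_two, LinearEquiv.mul_apply, geoRefl_apply, map_sub, map_smul, e1, e2,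
      geoForm_self, LinearEquiv.coe_one, id]
    module
  have h3 : 3 ≤ M i j := by omega
  ext1 v
  set m := M i j with hm
  set θ : ℝ := 2 * (Real.pi / (m : ℝ)) with hθ
  have hm0 : (m : ℝ) ≠ 0 := by exact_mod_cast h0
  have hmθ : (m : ℝ) * θ = 2 * Real.pi := by rw [hθ]; field_simp
  have hm3 : (3 : ℝ) ≤ m := by exact_mod_cast h3
  have hsin : Real.sin θ ≠ 0 := by
    apply ne_of_gt
    apply Real.sin_pos_of_pos_of_lt_pi
    · have := Real.pi_pos
      positivity
    · have := Real.pi_pos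
      nlinarith
  have ht : 2 * Real.cos θ =
      geoForm M i (Finsupp.single j 1) * geoForm M j (Finsupp.single i 1) - 2 := by
    rw [geoForm_single, geoForm_single, hsymm, ← hm, hθ, Real.cos_two_mul]
    ring
  have key := Module.reflection_mul_reflection_pow_apply (geoForm_self M i) (geoForm_self M j)
    m v (2 * Real.cos θ) ht
  have hS := Polynomial.Chebyshev.S_two_mul_real_cos θ
  change ((Module.reflection (geoForm_self M i) * Module.reflection (geoForm_self M j)) ^ m) v = v
  rw [key]
  rcases Nat.even_or_odd' m with ⟨k, hk | hk⟩
  · have a1 : ((m : ℤ) - 2) / 2 = (k : ℤ) - 1 := by omega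
    have a2 : ((m : ℤ) - 1) / 2 = (k : ℤ) - 1 := by omega
    have z : (Polynomial.Chebyshev.S ℝ ((k : ℤ) - 1)).eval (2 * Real.cos θ) = 0 := by
      have h := hS ((k : ℤ) - 1)
      have hkθ : (k : ℝ) * θ = Real.pi := by
        have : (m : ℝ) = 2 * k := by exact_mod_cast hk
        rw [this] at hmθ
        linarith
      have : (((k : ℤ) - 1 : ℤ) + 1 : ℝ) * θ = Real.pi := by
        push_cast
        linarith
      rw [this, Real.sin_pi] at h
      exact (mul_eq_zero.mp h).resolve_right hsin
    rw [a1, a2, z]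
    simp
  · have a1 : ((m : ℤ) - 2) / 2 = (k : ℤ) - 1 := by omega
    have a2 : ((m : ℤ) - 1) / 2 = (k : ℤ) := by omega
    have a3 : ((m : ℤ) - 3) / 2 = (k : ℤ) - 1 := by omega
    have a4 : (m : ℤ) / 2 = (k : ℤ) := by omega
    have z : (Polynomial.Chebyshev.S ℝ (k : ℤ)).eval (2 * Real.cos θ)
        + (Polynomial.Chebyshev.S ℝ ((k : ℤ) - 1)).eval (2 * Real.cos θ) = 0 := by
      have h := hS ((k : ℤ) - 1)
      have h' := hS (k : ℤ)
      have hkθ : (2 * (k : ℝ) + 1) * θ = 2 * Real.pi := by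
        have : (m : ℝ) = 2 * k + 1 := by exact_mod_cast hk
        rw [this] at hmθ
        linarith
      have e1 : (((k : ℤ) - 1 : ℤ) + 1 : ℝ) * θ = (k : ℝ) * θ := by
        push_cast
        ring
      have e2 : (((k : ℤ) : ℝ) + 1) * θ = 2 * Real.pi - (k : ℝ) * θ := by
        push_cast
        linarith
      rw [e1] at h
      rw [e2, Real.sin_two_pi_sub] at h'
      have : ((Polynomial.Chebyshev.S ℝ (k : ℤ)).eval (2 * Real.cos θ)
        + (Polynomial.Chebyshev.S ℝ ((k : ℤ) - 1)).eval (2 * Real.cos θ)) * Real.sin θ = 0 := by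
        rw [add_mul, h, h']
        ring
      exact (mul_eq_zero.mp this).resolve_right hsin
    rw [a1, a2, a3, a4, z]
    simp

/-- Independence of the simple reflections: `s_t ∉ W_J` if `t ∉ J`. -/
theorem simple_notMem_par (cs : CoxeterSystem M W) (J : Set B) (t : B) (ht : t ∉ J) :
    cs.simple t ∉ par cs J := by
  intro hmem
  let ρ := cs.lift ⟨geoRefl M, geo_liftable M⟩
  have hρ (i : B) : ρ (cs.simple i) = geoRefl M i := cs.lift_apply_simple (geo_liftable M) i
  have key : ∀ w ∈ par cs J, ∀ v : B →₀ ℝ, (ρ w v) t = v t := by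
    intro w hw
    induction hw using Subgroup.closure_induction with
    | mem x hx =>
      obtain ⟨j, hj, rfl⟩ := hx
      intro v
      have : j ≠ t := fun h => ht (h ▸ hj)
      rw [hρ, geoRefl_apply]
      simp [this]
    | one => intro v; simp
    | mul x y _ _ hx hy => intro v; rw [map_mul, LinearEquiv.mul_apply, hx, hy]
    | inv x _ hx =>
      intro v
      have := hx (ρ x⁻¹ v)
      rw [← LinearEquiv.mul_apply, ← map_mul] at this
      simpa using this.symm
  have h := key _ hmem (Finsupp.single t 1)
  rw [hρ, geoRefl_apply, geoForm_self] at h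
  simp at h

open Classical in
/-- The simple generators of Tits' permutation representation on `W × ℤ/2`. -/
noncomputable def titsPerm (cs : CoxeterSystem M W) (i : B) : Equiv.Perm (W × ZMod 2) :=
  Function.Involutive.toPerm
    (fun p => (cs.simple i * p.1 * cs.simple i, p.2 + if p.1 = cs.simple i then 1 else 0)) (by
      rintro ⟨r, e⟩
      have h : cs.simple i * r * cs.simple i = cs.simple i ↔ r = cs.simple i := by
        constructor
        · intro h
          have h' := congrArg (fun x => cs.simple i * x * cs.simple i) h
          simpa [mul_assoc] using h'
        · rintro rfl
          simp
      ext
      · simp [mul_assoc]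
      · simp only [h]
        split_ifs
        · rw [add_assoc, CharTwo.add_self_eq_zero, add_zero]
        · simp)

open Classical in
theorem titsPerm_apply (cs : CoxeterSystem M W) (i : B) (r : W) (e : ZMod 2) :
    titsPerm cs i (r, e) =
      (cs.simple i * r * cs.simple i, e + if r = cs.simple i then 1 else 0) := rfl

open Classical in
theorem titsPerm_word (cs : CoxeterSystem M W) (ω : List B) (r : W) (e : ZMod 2) :
    (ω.map (titsPerm cs)).prod (r, e) =
      (cs.wordProd ω * r * (cs.wordProd ω)⁻¹, e + ((cs.rightInvSeq ω).count r : ZMod 2)) := by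
  induction ω with
  | nil => simp
  | cons i ω ih =>
    rw [List.map_cons, List.prod_cons, Equiv.Perm.mul_apply, ih, titsPerm_apply]
    have h : cs.wordProd ω * r * (cs.wordProd ω)⁻¹ = cs.simple i ↔
        (cs.wordProd ω)⁻¹ * cs.simple i * cs.wordProd ω = r := by
      constructor
      · intro h
        rw [← h]
        group
      · intro h
        rw [← h]
        group
    ext
    · simp [cs.wordProd_cons, mul_assoc]
    · simp only [CoxeterSystem.rightInvSeq, List.count_cons, h, beq_iff_eq]
      push_cast
      ring

theorem prod_map_alternatingWord {G : Type*} [Monoid G] (f : B → G) (i j : B) (m : ℕ) :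
    ((CoxeterSystem.alternatingWord i j (2 * m)).map f).prod = (f i * f j) ^ m := by
  induction m with
  | zero => simp [CoxeterSystem.alternatingWord]
  | succ m ih =>
    rw [show 2 * (m + 1) = 2 * m + 1 + 1 by ring, CoxeterSystem.alternatingWord_succ,
      CoxeterSystem.alternatingWord_succ, pow_succ, ← ih]
    simp [mul_assoc]

theorem reverse_alternatingWord (i j : B) (m : ℕ) :
    (CoxeterSystem.alternatingWord i j (2 * m)).reverse =
      CoxeterSystem.alternatingWord j i (2 * m) := by
  induction m with
  | zero => simp [CoxeterSystem.alternatingWord]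
  | succ m ih =>
    rw [show 2 * (m + 1) = 2 * m + 1 + 1 by ring, CoxeterSystem.alternatingWord_succ,
      CoxeterSystem.alternatingWord_succ, CoxeterSystem.alternatingWord_succ' j i,
      CoxeterSystem.alternatingWord_succ' j i, ← ih]
    simp

theorem lis_alternatingWord (cs : CoxeterSystem M W) (i j : B) :
    ∃ L : List W, cs.leftInvSeq (CoxeterSystem.alternatingWord i j (2 * M i j)) = L ++ L := by
  set m := M i j with hm
  set N := cs.leftInvSeq (CoxeterSystem.alternatingWord i j (2 * m)) with hN
  have hlen : N.length = 2 * m := by simp [hN]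
  refine ⟨N.take m, ?_⟩
  apply List.ext_getElem
  · simp [hlen]; omega
  intro k h1 h2
  rw [List.getElem_append]
  split_ifs with h
  · simp
  · simp only [List.length_take, hlen] at h ⊢
    rw [List.getElem_take]
    have hmin : min m (2 * m) = m := by omega
    have hk : m ≤ k := by omega
    have e1 := cs.getElem_leftInvSeq_alternatingWord i j m k (by omega)
    have e2 := cs.getElem_leftInvSeq_alternatingWord i j m (k - m) (by omega)
    simp only [hmin]
    refine e1.trans (Eq.trans ?_ e2.symm)
    rw [cs.prod_alternatingWord_eq_mul_pow, cs.prod_alternatingWord_eq_mul_pow]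
    have o1 : ¬ Even (2 * k + 1) := by simp
    have o2 : ¬ Even (2 * (k - m) + 1) := by simp
    rw [if_neg o1, if_neg o2]
    have d1 : (2 * k + 1) / 2 = m + (k - m) := by omega
    have d2 : (2 * (k - m) + 1) / 2 = k - m := by omega
    rw [d1, d2, pow_add, hm, cs.simple_mul_simple_pow', one_mul]

theorem tits_liftable (cs : CoxeterSystem M W) : M.IsLiftable (titsPerm cs) := by
  classical
  intro i j
  rw [← prod_map_alternatingWord]
  ext1 ⟨r, e⟩
  rw [titsPerm_word]
  have hw : cs.wordProd (CoxeterSystem.alternatingWord i j (2 * M i j)) = 1 := by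
    rw [cs.prod_alternatingWord_eq_mul_pow]
    simp
  have hc : ((cs.rightInvSeq (CoxeterSystem.alternatingWord i j (2 * M i j))).count r :
      ZMod 2) = 0 := by
    have h := cs.rightInvSeq_reverse (CoxeterSystem.alternatingWord j i (2 * M i j))
    rw [reverse_alternatingWord] at h
    rw [h, List.count_reverse]
    obtain ⟨L, hL⟩ := lis_alternatingWord cs j i
    rw [M.symmetric j i] at hL
    rw [hL, List.count_append]
    push_cast
    exact CharTwo.add_self_eq_zero _
  rw [hw, hc]
  simp

/-- Multiplying an element of `W_J` by `s_t`, `t ∉ J`, increases its length. -/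
theorem length_lt_mul_simple (cs : CoxeterSystem M W) (J : Set B) (t : B) (ht : t ∉ J)
    (w : W) (hw : w ∈ par cs J) : cs.length w < cs.length (w * cs.simple t) := by
  classical
  let φ := cs.lift ⟨titsPerm cs, tits_liftable cs⟩
  have hφ (i : B) : φ (cs.simple i) = titsPerm cs i := cs.lift_apply_simple (tits_liftable cs) i
  have key : ∀ w ∈ par cs J, ∀ r ∉ par cs J, ∀ e, φ w (r, e) = (w * r * w⁻¹, e) := by
    intro w hw
    induction hw using Subgroup.closure_induction with
    | mem x hx =>
      intro r hr e
      have hx' : x ∈ par cs J := Subgroup.subset_closure hx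
      obtain ⟨j, hj, rfl⟩ := hx
      have : r ≠ cs.simple j := fun h => hr (h ▸ hx')
      rw [hφ, titsPerm_apply]
      simp [this]
    | one => intro r hr e; simp
    | mul x y hx' hy' hx hy =>
      intro r hr e
      have : y * r * y⁻¹ ∉ par cs J := by
        intro h
        apply hr
        have := mul_mem (mul_mem (inv_mem hy') h) hy'
        simpa [mul_assoc, par] using this
      rw [map_mul, Equiv.Perm.mul_apply, hy r hr, hx _ this]
      simp [mul_assoc]
    | inv x hx' hx =>
      intro r hr e
      have : x⁻¹ * r * x ∉ par cs J := by
        intro h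
        apply hr
        have := mul_mem (mul_mem hx' h) (inv_mem hx')
        simpa [mul_assoc, par] using this
      have h := hx _ this e
      rw [map_inv, Equiv.Perm.inv_eq_iff_eq]
      rw [inv_inv, h]
      simp [mul_assoc]
  have hst := simple_notMem_par cs J t ht
  have h1 : φ (w * cs.simple t) (cs.simple t, 0) = (w * cs.simple t * w⁻¹, 1) := by
    rw [map_mul, Equiv.Perm.mul_apply, hφ, titsPerm_apply]
    simp only [if_true, zero_add]
    rw [cs.simple_mul_simple_self, one_mul, key w hw _ hst]
  obtain ⟨ω, hω, hwω⟩ := cs.exists_isReduced (w * cs.simple t)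
  have h2 : φ (cs.wordProd ω) = (ω.map (titsPerm cs)).prod := by
    rw [CoxeterSystem.wordProd, map_list_prod, List.map_map]
    congr 1
    apply List.map_congr_left
    intro i _
    exact hφ i
  rw [hwω, h2, titsPerm_word] at h1
  have h3 := congrArg Prod.snd h1
  simp only [zero_add] at h3
  have h4 : cs.simple t ∈ cs.rightInvSeq ω := by
    by_contra hn
    rw [List.count_eq_zero_of_not_mem hn] at h3
    simp at h3
  have h5 := (cs.isRightInversion_of_mem_rightInvSeq hω h4).2
  rw [← hwω] at h5
  simpa [mul_assoc] using h5

theorem statement_15 (cs : CoxeterSystem M W)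
    (K : Set B) (hK : Finitary cs K) (s t : B) (hs : s ∈ K) (ht : t ∈ K)
    (wK wJ : W) (hwK : IsLongest cs K wK) (hwJ : IsLongest cs (K \ {t}) wJ)
    (hts : cs.simple t = wK * cs.simple s * wK) :
    (cs.length (wK * wJ * wK) : ℤ) < 2 * (cs.length wK : ℤ) - cs.length wJ := by
  have hle : par cs (K \ {t}) ≤ par cs K :=
    Subgroup.closure_mono (Set.image_mono Set.sdiff_subset)
  have hJ : wJ ∈ par cs K := hle hwJ.1
  have htK : cs.simple t ∈ par cs K := Subgroup.subset_closure ⟨t, ht, rfl⟩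
  have h1 := length_lt_mul_simple cs (K \ {t}) t (by simp) wJ hwJ.1
  have h2 := hwK.2 _ (mul_mem hJ htK)
  have h3 := hwK.2 _ (mul_mem (mul_mem hwK.1 hJ) hwK.1)
  omega

end CoxeterAtoms
end
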